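/- Consider the DTP-Student-t modal regression model: for an n × p real design matrix X of full rank with p ≤ n and finite entries, with rows X₁ᵀ, …, X_nᵀ, observations y₁, …, y_n ∈ ℝ, the likelihood ∏_{i=1}^{n} f_DTP(y_i | X_iᵀβ, σ₁, σ₂, δ₁, δ₂), independent InverseGamma(1,1) prior densities p(x) = x^{−2} e^{−1/x} on each of σ₁, σ₂, δ₁, δ₂ > 0, and the flat prior p(β) ∝ 1 on β ∈ ℝ^p. Then the posterior distribution is proper, i.e., the integral of the likelihood times the prior densities over (β, σ₁, σ₂, δ₁, δ₂) ∈ ℝ^p × (0,∞)^4 is finite. -/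

import Mathlib

open MeasureTheory

/-- The standardized Student-t density with degrees of freedom `δ`. -/
noncomputable def gStudent (δ z : ℝ) : ℝ :=
  Real.Gamma ((δ + 1) / 2) / (Real.Gamma (δ / 2) * Real.sqrt (δ * Real.pi)) *
    (1 + z ^ 2 / δ) ^ (-(δ + 1) / 2)

/-- The DTP mixing weight. -/
noncomputable def wDTP (σ₁ σ₂ δ₁ δ₂ : ℝ) : ℝ :=
  σ₁ * gStudent δ₂ 0 / (σ₁ * gStudent δ₂ 0 + σ₂ * gStudent δ₁ 0)

/-- The DTP-Student-t density with mode `θ`, scales `σ₁, σ₂`, and shapes `δ₁, δ₂`. -/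
noncomputable def fDTP (θ σ₁ σ₂ δ₁ δ₂ y : ℝ) : ℝ :=
  if y < θ then wDTP σ₁ σ₂ δ₁ δ₂ * (2 / σ₁) * gStudent δ₁ ((y - θ) / σ₁)
  else (1 - wDTP σ₁ σ₂ δ₁ δ₂) * (2 / σ₂) * gStudent δ₂ ((y - θ) / σ₂)

/-- The InverseGamma(1,1) density. -/
noncomputable def invGamma11 (x : ℝ) : ℝ := x ^ (-2 : ℝ) * Real.exp (-1 / x)

theorem lintegral_pi_prod {n : ℕ} (f : Fin n → ℝ → ENNReal) (hf : ∀ i, Measurable (f i)) :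
    ∫⁻ x : Fin n → ℝ, ∏ i, f i (x i) = ∏ i, ∫⁻ t, f i t := by
  induction n with
  | zero => simp [volume_pi]
  | succ n ih =>
    have hmp := (volume_preserving_piFinSuccAbove (fun _ : Fin (n + 1) => ℝ) 0).symm
    rw [← hmp.lintegral_comp_emb (MeasurableEquiv.measurableEmbedding _)]
    simp only [Fin.prod_univ_succ, MeasurableEquiv.piFinSuccAbove_symm_apply, Fin.insertNthEquiv,
      Equiv.coe_fn_mk, Fin.insertNth_zero, Fin.cons_zero, Fin.cons_succ]
    rw [← ih (fun i => f i.succ) fun i => hf i.succ]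
    exact lintegral_prod_mul (hf 0).aemeasurable
      (Finset.measurable_fun_prod _ fun i _ => (hf _).comp (measurable_pi_apply i)).aemeasurable

theorem lintegral_mulVec_prod {p : ℕ} (A : Matrix (Fin p) (Fin p) ℝ) (hA : A.det ≠ 0)
    (f : Fin p → ℝ → ENNReal) (hf : ∀ i, Measurable (f i)) :
    ∫⁻ x : Fin p → ℝ, ∏ i, f i (∑ j, A i j * x j) =
      ENNReal.ofReal |A.det⁻¹| * ∏ i, ∫⁻ t, f i t := by
  have hmeas : Measurable fun x : Fin p → ℝ => ∏ i, f i (x i) :=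
    Finset.measurable_fun_prod _ fun i _ => (hf i).comp (measurable_pi_apply i)
  have hlin : Measurable (Matrix.toLin' A) :=
    (LinearMap.continuous_of_finiteDimensional _).measurable
  have h := lintegral_map (μ := volume) hmeas hlin
  rw [Real.map_matrix_volume_pi_eq_smul_volume_pi hA, lintegral_smul_measure,
    lintegral_pi_prod f hf] at h
  exact h.symm

theorem Matrix.exists_det_submatrix_ne_zero {n p : ℕ} (X : Matrix (Fin n) (Fin p) ℝ)
    (hrank : X.rank = p) :
    ∃ e : Fin p → Fin n, Function.Injective e ∧ (X.submatrix e id).det ≠ 0 := by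
  obtain ⟨f, hf, -, hli⟩ := Submodule.exists_fun_fin_finrank_span_eq ℝ (Set.range X.row)
  rw [X.rank_eq_finrank_span_row] at hrank
  have hli' := hli.comp _ (finCongr hrank.symm).injective
  choose e he using fun i => hf (finCongr hrank.symm i)
  have hrow : (X.submatrix e id).row = f ∘ finCongr hrank.symm := funext he
  refine ⟨e, fun a b hab => ?_, ?_⟩
  · apply hli'.injective
    simp only [Function.comp, ← he, hab]
  · rw [← hrow, Matrix.linearIndependent_rows_iff_isUnit, Matrix.isUnit_iff_isUnit_det] at hli'
    exact hli'.ne_zero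

theorem lintegral_rpow_mul_exp_neg_mul_Ioi {a r : ℝ} (ha : 0 < a) (hr : 0 < r) :
    ∫⁻ t in Set.Ioi (0:ℝ), ENNReal.ofReal (t ^ (a - 1) * Real.exp (-(r * t))) =
      ENNReal.ofReal ((1 / r) ^ a * Real.Gamma a) := by
  rw [← Real.integral_rpow_mul_exp_neg_mul_Ioi ha hr, ofReal_integral_eq_lintegral_ofReal]
  · have h := integrableOn_rpow_mul_exp_neg_mul_rpow (p := 1) (s := a - 1) (by linarith) one_pos hr
    simpa [IntegrableOn] using h
  · filter_upwards [self_mem_ae_restrict measurableSet_Ioi] with t ht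
    have : (0:ℝ) < t := ht
    simp only [Pi.zero_apply]
    positivity

theorem lintegral_gaussian {b : ℝ} (hb : 0 < b) :
    ∫⁻ z : ℝ, ENNReal.ofReal (Real.exp (-b * z ^ 2)) = ENNReal.ofReal (√(Real.pi / b)) := by
  rw [← integral_gaussian, ofReal_integral_eq_lintegral_ofReal (integrable_exp_neg_mul_sq hb)]
  exact Filter.Eventually.of_forall fun _ => (Real.exp_pos _).le

/-- The Student-t normalisation, from writing the kernel as a Gamma mixture of Gaussians. -/
theorem lintegral_one_add_sq_div_rpow {δ : ℝ} (hδ : 0 < δ) :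
    ∫⁻ z : ℝ, ENNReal.ofReal (Real.Gamma ((δ + 1) / 2) * (1 + z ^ 2 / δ) ^ (-(δ + 1) / 2)) =
      ENNReal.ofReal (Real.Gamma (δ / 2) * √(δ * Real.pi)) := by
  calc
    _ = ∫⁻ z : ℝ, ∫⁻ t in Set.Ioi (0:ℝ), ENNReal.ofReal
          (t ^ ((δ + 1) / 2 - 1) * Real.exp (-((1 + z ^ 2 / δ) * t))) := by
      refine lintegral_congr fun z => ?_
      have hr : 0 < 1 + z ^ 2 / δ := by positivity
      rw [lintegral_rpow_mul_exp_neg_mul_Ioi (by linarith) hr, one_div,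
        Real.inv_rpow hr.le, ← Real.rpow_neg hr.le, mul_comm, neg_div]
    _ = ∫⁻ t in Set.Ioi (0:ℝ), ∫⁻ z : ℝ, ENNReal.ofReal
          (t ^ ((δ + 1) / 2 - 1) * Real.exp (-((1 + z ^ 2 / δ) * t))) := by
      refine lintegral_lintegral_swap (Measurable.aemeasurable ?_)
      unfold Function.uncurry
      fun_prop
    _ = ∫⁻ t in Set.Ioi (0:ℝ), ENNReal.ofReal (√(δ * Real.pi)) *
          ENNReal.ofReal (t ^ (δ / 2 - 1) * Real.exp (-(1 * t))) := by
      refine setLIntegral_congr_fun measurableSet_Ioi fun t (ht : 0 < t) => ?_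
      have hsplit : ∀ z : ℝ, ENNReal.ofReal
          (t ^ ((δ + 1) / 2 - 1) * Real.exp (-((1 + z ^ 2 / δ) * t))) =
          ENNReal.ofReal (t ^ ((δ + 1) / 2 - 1) * Real.exp (-t)) *
            ENNReal.ofReal (Real.exp (-(t / δ) * z ^ 2)) := fun z => by
        rw [← ENNReal.ofReal_mul (by positivity), mul_assoc, ← Real.exp_add]
        congr 3
        ring
      simp only [hsplit]
      rw [lintegral_const_mul' _ _ ENNReal.ofReal_ne_top, lintegral_gaussian (by positivity),
        ← ENNReal.ofReal_mul (by positivity), ← ENNReal.ofReal_mul (by positivity)]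
      congr 1
      rw [show Real.pi / (t / δ) = δ * Real.pi / t by field_simp, Real.sqrt_div' _ ht.le,
        show (δ + 1) / 2 - 1 = (δ / 2 - 1) + 1 / 2 by ring, Real.rpow_add ht,
        ← Real.sqrt_eq_rpow, one_mul]
      have : √t ≠ 0 := (Real.sqrt_pos.2 ht).ne'
      field_simp
    _ = _ := by
      rw [lintegral_const_mul' _ _ ENNReal.ofReal_ne_top,
        lintegral_rpow_mul_exp_neg_mul_Ioi (by positivity) one_pos,
        ← ENNReal.ofReal_mul (by positivity)]
      simp [mul_comm]

theorem gStudent_nonneg {δ : ℝ} (hδ : 0 < δ) (z : ℝ) : 0 ≤ gStudent δ z := by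
  have := Real.Gamma_pos_of_pos (half_pos hδ)
  have := Real.Gamma_pos_of_pos (show 0 < (δ + 1) / 2 by positivity)
  unfold gStudent
  positivity

theorem gStudent_zero_pos {δ : ℝ} (hδ : 0 < δ) : 0 < gStudent δ 0 := by
  have := Real.Gamma_pos_of_pos (half_pos hδ)
  have := Real.Gamma_pos_of_pos (show 0 < (δ + 1) / 2 by positivity)
  unfold gStudent
  positivity

theorem measurable_gStudent (δ : ℝ) : Measurable (gStudent δ) := by
  unfold gStudent
  fun_prop

theorem gStudent_le_gStudent_zero {δ : ℝ} (hδ : 0 < δ) (z : ℝ) :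
    gStudent δ z ≤ gStudent δ 0 := by
  have := Real.Gamma_pos_of_pos (half_pos hδ)
  have := Real.Gamma_pos_of_pos (show 0 < (δ + 1) / 2 by positivity)
  have h : 1 ≤ 1 + z ^ 2 / δ := le_add_of_nonneg_right (by positivity)
  have := Real.rpow_le_one_of_one_le_of_nonpos h (show -(δ + 1) / 2 ≤ 0 by linarith)
  unfold gStudent
  refine mul_le_mul_of_nonneg_left (this.trans_eq ?_) (by positivity)
  norm_num

theorem gStudent_zero_le_one {δ : ℝ} (hδ : 0 < δ) : gStudent δ 0 ≤ 1 := by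
  have hδ2 := half_pos hδ
  have hG := Real.Gamma_pos_of_pos hδ2
  have h := Real.Gamma_mul_add_mul_le_rpow_Gamma_mul_rpow_Gamma hδ2
    (add_pos hδ2 one_pos) (half_pos one_pos) (half_pos one_pos) (add_halves 1)
  rw [Real.Gamma_add_one hδ2.ne', ← Real.mul_rpow hG.le (by positivity),
    ← Real.sqrt_eq_rpow, show Real.Gamma (δ / 2) * (δ / 2 * Real.Gamma (δ / 2)) =
      Real.Gamma (δ / 2) ^ 2 * (δ / 2) by ring, Real.sqrt_mul (by positivity),
    Real.sqrt_sq hG.le, show 1 / 2 * (δ / 2) + 1 / 2 * (δ / 2 + 1) = (δ + 1) / 2 by ring] at h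
  have hsqrt : √(δ / 2) ≤ √(δ * Real.pi) :=
    Real.sqrt_le_sqrt (by nlinarith [Real.pi_gt_three])
  unfold gStudent
  norm_num
  exact div_le_one_of_le₀ (h.trans (mul_le_mul_of_nonneg_left hsqrt hG.le)) (by positivity)

theorem lintegral_gStudent {δ : ℝ} (hδ : 0 < δ) :
    ∫⁻ z : ℝ, ENNReal.ofReal (gStudent δ z) = 1 := by
  have hpos : 0 < Real.Gamma (δ / 2) * √(δ * Real.pi) := by
    have := Real.Gamma_pos_of_pos (half_pos hδ)
    positivity
  have h : ∀ z, ENNReal.ofReal (gStudent δ z) =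
      ENNReal.ofReal (Real.Gamma (δ / 2) * √(δ * Real.pi))⁻¹ *
        ENNReal.ofReal (Real.Gamma ((δ + 1) / 2) * (1 + z ^ 2 / δ) ^ (-(δ + 1) / 2)) :=
    fun z => by
      rw [← ENNReal.ofReal_mul (by positivity)]
      congr 1
      unfold gStudent
      ring
  simp only [h]
  rw [lintegral_const_mul' _ _ ENNReal.ofReal_ne_top, lintegral_one_add_sq_div_rpow hδ,
    ← ENNReal.ofReal_mul (by positivity), inv_mul_cancel₀ hpos.ne', ENNReal.ofReal_one]

theorem lintegral_gStudent_sub_div {δ σ : ℝ} (hδ : 0 < δ) (hσ : 0 < σ) (y : ℝ) :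
    ∫⁻ θ : ℝ, ENNReal.ofReal (gStudent δ ((y - θ) / σ)) = ENNReal.ofReal σ := by
  rw [lintegral_sub_left_eq_self (fun x => ENNReal.ofReal (gStudent δ (x / σ)))]
  have h := lintegral_map (μ := volume) (measurable_gStudent δ).ennreal_ofReal
    (measurable_const_mul σ⁻¹)
  rw [Real.map_volume_mul_left (inv_ne_zero hσ.ne'), lintegral_smul_measure,
    lintegral_gStudent hδ, inv_inv, abs_of_pos hσ, smul_eq_mul, mul_one] at h
  simp only [div_eq_inv_mul]
  exact h.symm

theorem wDTP_mem_Icc {σ₁ σ₂ δ₁ δ₂ : ℝ} (hσ₁ : 0 < σ₁) (hσ₂ : 0 < σ₂) (hδ₁ : 0 < δ₁)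
    (hδ₂ : 0 < δ₂) : wDTP σ₁ σ₂ δ₁ δ₂ ∈ Set.Icc 0 1 := by
  have h₁ := gStudent_zero_pos hδ₁
  have h₂ := gStudent_zero_pos hδ₂
  unfold wDTP
  exact ⟨by positivity, div_le_one_of_le₀ (le_add_of_nonneg_right (by positivity)) (by positivity)⟩

theorem fDTP_nonneg {σ₁ σ₂ δ₁ δ₂ : ℝ} (hσ₁ : 0 < σ₁) (hσ₂ : 0 < σ₂) (hδ₁ : 0 < δ₁)
    (hδ₂ : 0 < δ₂) (θ y : ℝ) : 0 ≤ fDTP θ σ₁ σ₂ δ₁ δ₂ y := by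
  obtain ⟨hw₀, hw₁⟩ := wDTP_mem_Icc hσ₁ hσ₂ hδ₁ hδ₂
  have h₁ := gStudent_nonneg hδ₁ ((y - θ) / σ₁)
  have h₂ := gStudent_nonneg hδ₂ ((y - θ) / σ₂)
  have := sub_nonneg.2 hw₁
  unfold fDTP
  split_ifs <;> positivity

theorem fDTP_le {σ₁ σ₂ δ₁ δ₂ : ℝ} (hσ₁ : 0 < σ₁) (hσ₂ : 0 < σ₂) (hδ₁ : 0 < δ₁)
    (hδ₂ : 0 < δ₂) (θ y : ℝ) : fDTP θ σ₁ σ₂ δ₁ δ₂ y ≤ 2 / σ₁ := by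
  obtain ⟨hw₀, hw₁⟩ := wDTP_mem_Icc hσ₁ hσ₂ hδ₁ hδ₂
  have h₁ := gStudent_zero_pos hδ₁
  have h₂ := gStudent_zero_pos hδ₂
  have hle₁ := gStudent_zero_le_one hδ₁
  have := sub_nonneg.2 hw₁
  unfold fDTP
  split_ifs
  · calc
      _ ≤ 1 * (2 / σ₁) * 1 := by
        gcongr
        · exact gStudent_nonneg hδ₁ _
        · exact (gStudent_le_gStudent_zero hδ₁ _).trans hle₁
      _ = 2 / σ₁ := by ring
  · calc
      _ ≤ (1 - wDTP σ₁ σ₂ δ₁ δ₂) * (2 / σ₂) * gStudent δ₂ 0 := by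
        gcongr
        exact gStudent_le_gStudent_zero hδ₂ _
      _ = 2 * gStudent δ₁ 0 * (gStudent δ₂ 0 /
            (σ₁ * gStudent δ₂ 0 + σ₂ * gStudent δ₁ 0)) := by
        unfold wDTP
        field_simp
        ring
      _ ≤ 2 * 1 * (gStudent δ₂ 0 / (σ₁ * gStudent δ₂ 0)) := by
        gcongr
        exact le_add_of_nonneg_right (by positivity)
      _ = 2 / σ₁ := by field_simp

theorem measurable_fDTP (σ₁ σ₂ δ₁ δ₂ y : ℝ) : Measurable fun θ => fDTP θ σ₁ σ₂ δ₁ δ₂ y := by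
  have h := measurable_gStudent
  unfold fDTP
  exact Measurable.ite measurableSet_Ioi
    (((h δ₁).comp (by fun_prop)).const_mul _) (((h δ₂).comp (by fun_prop)).const_mul _)

theorem lintegral_fDTP_le {σ₁ σ₂ δ₁ δ₂ : ℝ} (hσ₁ : 0 < σ₁) (hσ₂ : 0 < σ₂) (hδ₁ : 0 < δ₁)
    (hδ₂ : 0 < δ₂) (y : ℝ) : ∫⁻ θ, ENNReal.ofReal (fDTP θ σ₁ σ₂ δ₁ δ₂ y) ≤ 2 := by
  obtain ⟨hw₀, hw₁⟩ := wDTP_mem_Icc hσ₁ hσ₂ hδ₁ hδ₂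
  have hw₁' := sub_nonneg.2 hw₁
  set w := wDTP σ₁ σ₂ δ₁ δ₂ with hw
  calc
    _ ≤ ∫⁻ θ, (ENNReal.ofReal (w * (2 / σ₁)) * ENNReal.ofReal (gStudent δ₁ ((y - θ) / σ₁)) +
          ENNReal.ofReal ((1 - w) * (2 / σ₂)) *
            ENNReal.ofReal (gStudent δ₂ ((y - θ) / σ₂))) := by
      refine lintegral_mono fun θ => ?_
      simp only [fDTP, ← hw]
      rw [← ENNReal.ofReal_mul (by positivity), ← ENNReal.ofReal_mul (by positivity)]
      split_ifs
      · exact le_self_add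
      · exact le_add_self
    _ = 2 := by
      have hmeas : Measurable fun θ => ENNReal.ofReal (w * (2 / σ₁)) *
          ENNReal.ofReal (gStudent δ₁ ((y - θ) / σ₁)) :=
        ((measurable_gStudent δ₁).comp (by fun_prop)).ennreal_ofReal.const_mul _
      rw [lintegral_add_left hmeas, lintegral_const_mul' _ _ ENNReal.ofReal_ne_top,
        lintegral_const_mul' _ _ ENNReal.ofReal_ne_top, lintegral_gStudent_sub_div hδ₁ hσ₁,
        lintegral_gStudent_sub_div hδ₂ hσ₂, ← ENNReal.ofReal_mul (by positivity),
        ← ENNReal.ofReal_mul (by positivity), ← ENNReal.ofReal_add (by positivity) (by positivity),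
        show w * (2 / σ₁) * σ₁ + (1 - w) * (2 / σ₂) * σ₂ = 2 by field_simp; ring]
      norm_num

theorem inv_pow_mul_exp_neg_inv_le {x : ℝ} (hx : 0 < x) (k : ℕ) :
    x⁻¹ ^ k * Real.exp (-1 / x) ≤ k.factorial := by
  have h := Real.pow_div_factorial_le_exp x⁻¹ (by positivity) k
  rw [div_le_iff₀ (by positivity)] at h
  rw [show -1 / x = -x⁻¹ by ring, Real.exp_neg, ← div_eq_mul_inv, div_le_iff₀ (Real.exp_pos _),
    mul_comm]
  exact h

theorem invGamma11_nonneg {x : ℝ} (hx : 0 < x) : 0 ≤ invGamma11 x := by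
  unfold invGamma11
  positivity

theorem lintegral_inv_pow_mul_invGamma11_lt_top (m : ℕ) :
    ∫⁻ x in Set.Ioi (0:ℝ), ENNReal.ofReal (x⁻¹ ^ m * invGamma11 x) < ⊤ := by
  have hint : Integrable fun x : ℝ => ((m + 2).factorial + m.factorial : ℝ) * (1 + x ^ 2)⁻¹ :=
    integrable_inv_one_add_sq.const_mul _
  refine lt_of_le_of_lt ?_ (hint.restrict (s := Set.Ioi 0)).lintegral_lt_top
  refine setLIntegral_mono' measurableSet_Ioi fun x (hx : 0 < x) => ENNReal.ofReal_le_ofReal ?_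
  rw [← div_eq_mul_inv, le_div_iff₀ (by positivity)]
  calc
    _ = x⁻¹ ^ (m + 2) * Real.exp (-1 / x) + x⁻¹ ^ m * Real.exp (-1 / x) := by
      rw [invGamma11, Real.rpow_neg hx.le, Real.rpow_two, pow_add]
      field_simp
    _ ≤ _ := add_le_add (inv_pow_mul_exp_neg_inv_le hx _) (inv_pow_mul_exp_neg_inv_le hx _)

/-- Factors outside the range of an injection `e` are replaced by their upper bound `M`. -/
theorem prod_le_prod_comp_mul_pow {n p : ℕ} {e : Fin p → Fin n} (he : Function.Injective e)
    {f : Fin n → ℝ} {M : ℝ} (hf₀ : ∀ i, 0 ≤ f i) (hfM : ∀ i, f i ≤ M) :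
    ∏ i, f i ≤ (∏ k, f (e k)) * M ^ (n - p) := by
  classical
  rw [← Finset.prod_mul_prod_compl (Finset.univ.image e), Finset.prod_image he.injOn]
  refine mul_le_mul_of_nonneg_left ?_ (Finset.prod_nonneg fun _ _ => hf₀ _)
  refine (Finset.prod_le_prod (fun i _ => hf₀ i) fun i _ => hfM i).trans_eq ?_
  rw [Finset.prod_const, Finset.card_compl, Finset.card_image_of_injective _ he, Finset.card_fin,
    Fintype.card_fin]

theorem lintegral_prod_fDTP_le {n p : ℕ} (X : Matrix (Fin n) (Fin p) ℝ) (y : Fin n → ℝ)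
    {e : Fin p → Fin n} (he : Function.Injective e) (hdet : (X.submatrix e id).det ≠ 0)
    {σ₁ σ₂ δ₁ δ₂ : ℝ} (hσ₁ : 0 < σ₁) (hσ₂ : 0 < σ₂) (hδ₁ : 0 < δ₁) (hδ₂ : 0 < δ₂) :
    ∫⁻ β : Fin p → ℝ,
        ENNReal.ofReal (∏ i, fDTP (∑ j, X i j * β j) σ₁ σ₂ δ₁ δ₂ (y i)) ≤
      ENNReal.ofReal |(X.submatrix e id).det⁻¹| * 2 ^ p *
        ENNReal.ofReal ((2 / σ₁) ^ (n - p)) := by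
  calc
    _ ≤ ∫⁻ β : Fin p → ℝ, (∏ k, ENNReal.ofReal
          (fDTP (∑ j, X.submatrix e id k j * β j) σ₁ σ₂ δ₁ δ₂ (y (e k)))) *
            ENNReal.ofReal ((2 / σ₁) ^ (n - p)) := by
      refine lintegral_mono fun β => ?_
      have hnonneg := fun i => fDTP_nonneg hσ₁ hσ₂ hδ₁ hδ₂ (∑ j, X i j * β j) (y i)
      simp only [Matrix.submatrix_apply, id]
      rw [← ENNReal.ofReal_prod_of_nonneg fun k _ => hnonneg (e k), ← ENNReal.ofReal_mul
        (Finset.prod_nonneg fun k _ => hnonneg (e k))]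
      exact ENNReal.ofReal_le_ofReal (prod_le_prod_comp_mul_pow he hnonneg
        fun i => fDTP_le hσ₁ hσ₂ hδ₁ hδ₂ _ _)
    _ ≤ _ := by
      rw [lintegral_mul_const' _ _ ENNReal.ofReal_ne_top, lintegral_mulVec_prod _ hdet
        (fun k θ => ENNReal.ofReal (fDTP θ σ₁ σ₂ δ₁ δ₂ (y (e k))))
        fun k => (measurable_fDTP _ _ _ _ _).ennreal_ofReal]
      gcongr
      refine (Finset.prod_le_pow_card _ _ 2
        fun k _ => lintegral_fDTP_le hσ₁ hσ₂ hδ₁ hδ₂ _).trans_eq ?_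
      simp

/-- Posterior propriety of the DTP-Student-t modal regression model. -/
theorem posterior_propriety_DTP_Student_t
    (n p : ℕ) (hpn : p ≤ n)
    (X : Matrix (Fin n) (Fin p) ℝ) (hrank : X.rank = p)
    (y : Fin n → ℝ) :
    ∫⁻ σ₁ in Set.Ioi (0:ℝ), ∫⁻ σ₂ in Set.Ioi (0:ℝ),
      ∫⁻ δ₁ in Set.Ioi (0:ℝ), ∫⁻ δ₂ in Set.Ioi (0:ℝ),
        ∫⁻ β : Fin p → ℝ,
          ENNReal.ofReal ((∏ i, fDTP (∑ j, X i j * β j) σ₁ σ₂ δ₁ δ₂ (y i)) *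
            invGamma11 σ₁ * invGamma11 σ₂ * invGamma11 δ₁ * invGamma11 δ₂) < ⊤ := by
  obtain ⟨e, he, hdet⟩ := X.exists_det_submatrix_ne_zero hrank
  set C : ENNReal := ENNReal.ofReal |(X.submatrix e id).det⁻¹| * 2 ^ p *
    ENNReal.ofReal (2 ^ (n - p)) with hC
  have hCtop : C ≠ ⊤ := by finiteness
  set J : ENNReal := ∫⁻ x in Set.Ioi (0:ℝ), ENNReal.ofReal (invGamma11 x) with hJ
  have hJtop : J < ⊤ := by simpa using lintegral_inv_pow_mul_invGamma11_lt_top 0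
  have hbound : ∀ σ₁ ∈ Set.Ioi (0:ℝ), ∀ σ₂ ∈ Set.Ioi (0:ℝ), ∀ δ₁ ∈ Set.Ioi (0:ℝ),
      ∀ δ₂ ∈ Set.Ioi (0:ℝ), ∫⁻ β : Fin p → ℝ,
          ENNReal.ofReal ((∏ i, fDTP (∑ j, X i j * β j) σ₁ σ₂ δ₁ δ₂ (y i)) *
            invGamma11 σ₁ * invGamma11 σ₂ * invGamma11 δ₁ * invGamma11 δ₂) ≤
        C * ENNReal.ofReal (σ₁⁻¹ ^ (n - p) * invGamma11 σ₁) * ENNReal.ofReal (invGamma11 σ₂) *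
          ENNReal.ofReal (invGamma11 δ₁) * ENNReal.ofReal (invGamma11 δ₂) := by
    intro σ₁ (hσ₁ : 0 < σ₁) σ₂ (hσ₂ : 0 < σ₂) δ₁ (hδ₁ : 0 < δ₁) δ₂ (hδ₂ : 0 < δ₂)
    simp only [ENNReal.ofReal_mul' (invGamma11_nonneg hσ₁),
      ENNReal.ofReal_mul' (invGamma11_nonneg hσ₂), ENNReal.ofReal_mul' (invGamma11_nonneg hδ₁),
      ENNReal.ofReal_mul' (invGamma11_nonneg hδ₂),
      lintegral_mul_const' _ _ ENNReal.ofReal_ne_top, ← mul_assoc]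
    gcongr
    refine (lintegral_prod_fDTP_le X y he hdet hσ₁ hσ₂ hδ₁ hδ₂).trans_eq ?_
    rw [hC, mul_assoc _ (ENNReal.ofReal (2 ^ (n - p))), ← ENNReal.ofReal_mul (by positivity),
      ← mul_pow, ← div_eq_mul_inv]
  calc
    _ ≤ ∫⁻ σ₁ in Set.Ioi (0:ℝ), ∫⁻ σ₂ in Set.Ioi (0:ℝ),
        ∫⁻ δ₁ in Set.Ioi (0:ℝ), ∫⁻ δ₂ in Set.Ioi (0:ℝ),
          C * ENNReal.ofReal (σ₁⁻¹ ^ (n - p) * invGamma11 σ₁) * ENNReal.ofReal (invGamma11 σ₂) *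
            ENNReal.ofReal (invGamma11 δ₁) * ENNReal.ofReal (invGamma11 δ₂) :=
      setLIntegral_mono' measurableSet_Ioi fun σ₁ hσ₁ =>
        setLIntegral_mono' measurableSet_Ioi fun σ₂ hσ₂ =>
          setLIntegral_mono' measurableSet_Ioi fun δ₁ hδ₁ =>
            setLIntegral_mono' measurableSet_Ioi fun δ₂ hδ₂ =>
              hbound σ₁ hσ₁ σ₂ hσ₂ δ₁ hδ₁ δ₂ hδ₂
    _ = C * (∫⁻ x in Set.Ioi (0:ℝ), ENNReal.ofReal (x⁻¹ ^ (n - p) * invGamma11 x)) *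
          J * J * J := by
      have hfin : ∀ σ₁ σ₂ δ₁ : ℝ, C * ENNReal.ofReal (σ₁⁻¹ ^ (n - p) * invGamma11 σ₁) *
          ENNReal.ofReal (invGamma11 σ₂) * ENNReal.ofReal (invGamma11 δ₁) ≠ ⊤ :=
        fun _ _ _ => by finiteness
      have hfin' : ∀ σ₁ σ₂ : ℝ, C * ENNReal.ofReal (σ₁⁻¹ ^ (n - p) * invGamma11 σ₁) *
          ENNReal.ofReal (invGamma11 σ₂) ≠ ⊤ := fun _ _ => by finiteness
      have hfin'' : ∀ σ₁ : ℝ, C * ENNReal.ofReal (σ₁⁻¹ ^ (n - p) * invGamma11 σ₁) ≠ ⊤ :=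
        fun _ => by finiteness
      simp only [lintegral_const_mul' _ _ (hfin _ _ _), lintegral_const_mul' _ _ (hfin' _ _),
        lintegral_const_mul' _ _ (hfin'' _), lintegral_const_mul' _ _ hCtop,
        lintegral_mul_const' _ _ hJtop.ne, ← hJ]
    _ < ⊤ := by
      have := lintegral_inv_pow_mul_invGamma11_lt_top (n - p)
      finiteness
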